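/- Let p be a prime, k ≥ 4 an integer, n a positive integer, and X_1,…,X_k ⊆ F_p^n. Let δ' > 0 be such that the number of k-cycles in X_1×⋯×X_k equals δ' N^{k−1}, let θ ≥ 1 be such that for every i ∈ {1,…,k} each point of X_i occurs as the i-th coordinate of at most θ δ' N^{k−2} k-cycles, and set α = (θδ')^{1/(k−2)}. If the number of k-cycles that contain a bad tuple is at least (1/2) δ' N^{k−1}, then there exists a subset I ⊆ {1,…,k} with 2 ≤ |I| ≤ k−2 such that the number of k-cycles (x_1,…,x_k) for which (x_i)_{i∈I} is a bad I-tuple while (x_i)_{i∈J} is not a bad J-tuple for every nonempty proper subset J ⊊ I, is at least δ' N^{k−1} / 2^{k+1}. -/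

import Mathlib

open scoped Classical

/-- The set of k-cycles in X 0 x ... x X (k-1): tuples with i-th coordinate in X i
summing to zero. -/
noncomputable def cycleSet {V : Type} [AddCommGroup V] [Fintype V] (k : ℕ)
    (X : Fin k → Finset V) : Finset (Fin k → V) :=
  (Fintype.piFinset X).filter fun x => ∑ i, x i = 0

/-- An I-tuple (represented by a full tuple x, of which only the coordinates in I matter)
is bad if it can be extended in at least 2 * α^(k-|I|-1) * N^(k-|I|-1) different ways to a
k-cycle in X 0 x ... x X (k-1). -/
noncomputable def IsBad {V : Type} [AddCommGroup V] [Fintype V] (k : ℕ)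
    (X : Fin k → Finset V) (α N : ℝ) (I : Finset (Fin k)) (x : Fin k → V) : Prop :=
  2 * α ^ (k - I.card - 1) * N ^ (k - I.card - 1) ≤
    (((cycleSet k X).filter fun y => ∀ i ∈ I, y i = x i).card : ℝ)

theorem mem_cycleSet {V : Type} [AddCommGroup V] [Fintype V] {k : ℕ} {X : Fin k → Finset V}
    {x : Fin k → V} : x ∈ cycleSet k X ↔ (∀ i, x i ∈ X i) ∧ ∑ i, x i = 0 := by
  simp [cycleSet]

/-- A one-element tuple is never bad when every point lies in few cycles. -/
theorem not_isBad_singleton {V : Type} [AddCommGroup V] [Fintype V] {k : ℕ}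
    {X : Fin k → Finset V} {α N c : ℝ} (hc : 0 < c) (hN : 0 < N) (hα : α ^ (k - 2) = c)
    {i : Fin k} {x : Fin k → V}
    (hdeg : (((cycleSet k X).filter fun y => y i = x i).card : ℝ) ≤ c * N ^ (k - 2)) :
    ¬ IsBad k X α N {i} x := by
  intro h
  have hpos : 0 < c * N ^ (k - 2) := by positivity
  simp only [IsBad, Finset.card_singleton, Finset.mem_singleton, forall_eq, Nat.sub_sub,
    Nat.reduceAdd, hα] at h
  linarith

/-- If no singleton is bad, a bad tuple contains a minimal bad tuple on at least two
coordinates. -/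
theorem exists_minimal_isBad {V : Type} [AddCommGroup V] [Fintype V] {k : ℕ}
    {X : Fin k → Finset V} {α N : ℝ} {x : Fin k → V} (hx : ∀ i, ¬ IsBad k X α N {i} x)
    {I : Finset (Fin k)} (hI : I.Nonempty) (hbad : IsBad k X α N I x) :
    ∃ J ⊆ I, 2 ≤ J.card ∧ IsBad k X α N J x ∧
      ∀ K : Finset (Fin k), K ⊂ J → K.Nonempty → ¬ IsBad k X α N K x := by
  obtain ⟨J, hJI, hJ⟩ := exists_minimal_le_of_wellFoundedLT
    (fun J : Finset (Fin k) => J.Nonempty ∧ IsBad k X α N J x) I ⟨hI, hbad⟩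
  refine ⟨J, hJI, ?_, hJ.prop.2, fun K hKJ hK hKbad => hJ.not_prop_of_lt hKJ ⟨hK, hKbad⟩⟩
  by_contra! hcard
  obtain ⟨i, rfl⟩ := Finset.card_eq_one.mp
    (le_antisymm (Nat.lt_succ_iff.mp hcard) hJ.prop.1.card_pos)
  exact hx i hJ.prop.2

theorem pigeonhole_bad_tuples (p : ℕ) [hp : Fact p.Prime] (k : ℕ) (hk : 4 ≤ k)
    (n : ℕ) (hn : 0 < n) (X : Fin k → Finset (Fin n → ZMod p))
    (δ' θ : ℝ) (hδ' : 0 < δ')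
    (hnum : ((cycleSet k X).card : ℝ) = δ' * ((p : ℝ) ^ n) ^ (k - 1))
    (hθ : 1 ≤ θ)
    (hdeg : ∀ i : Fin k, ∀ a ∈ X i,
      (((cycleSet k X).filter fun x => x i = a).card : ℝ) ≤ θ * δ' * ((p : ℝ) ^ n) ^ (k - 2))
    (α : ℝ) (hα : α = (θ * δ') ^ (1 / ((k : ℝ) - 2)))
    (hmany : δ' * ((p : ℝ) ^ n) ^ (k - 1) / 2 ≤
      (((cycleSet k X).filter fun x => ∃ I : Finset (Fin k),
        1 ≤ I.card ∧ I.card ≤ k - 2 ∧ IsBad k X α ((p : ℝ) ^ n) I x).card : ℝ)) :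
    ∃ I : Finset (Fin k), 2 ≤ I.card ∧ I.card ≤ k - 2 ∧
      δ' * ((p : ℝ) ^ n) ^ (k - 1) / (2 : ℝ) ^ (k + 1) ≤
        (((cycleSet k X).filter fun x => IsBad k X α ((p : ℝ) ^ n) I x ∧
          ∀ J : Finset (Fin k), J ⊂ I → J.Nonempty →
            ¬ IsBad k X α ((p : ℝ) ^ n) J x).card : ℝ) := by
  have hN : (0 : ℝ) < (p : ℝ) ^ n := by
    have := hp.out.pos
    positivity
  have hc : 0 < θ * δ' := by positivity
  have hpow : α ^ (k - 2) = θ * δ' := by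
    rw [hα, one_div, ← Nat.cast_ofNat, ← Nat.cast_sub (by omega : 2 ≤ k)]
    exact Real.rpow_inv_natCast_pow hc.le (by omega)
  set N : ℝ := (p : ℝ) ^ n
  let S : Finset (Finset (Fin k)) := Finset.univ.filter fun I => 2 ≤ I.card ∧ I.card ≤ k - 2
  let F : Finset (Fin k) → Finset (Fin k → Fin n → ZMod p) := fun I =>
    (cycleSet k X).filter fun x => IsBad k X α N I x ∧
      ∀ J : Finset (Fin k), J ⊂ I → J.Nonempty → ¬ IsBad k X α N J x
  have hS : S.Nonempty := by
    obtain ⟨I, -, hI⟩ := Finset.exists_subset_card_eq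
      (s := (Finset.univ : Finset (Fin k))) (n := 2) (by simp; omega)
    exact ⟨I, by simp only [S, Finset.mem_filter, Finset.mem_univ, true_and]; omega⟩
  have hcover : ((cycleSet k X).filter fun x => ∃ I : Finset (Fin k),
      1 ≤ I.card ∧ I.card ≤ k - 2 ∧ IsBad k X α N I x) ⊆ S.biUnion F := by
    intro x hx
    obtain ⟨hxc, I, hI1, hI2, hbad⟩ := Finset.mem_filter.mp hx
    have hxX : ∀ i, x i ∈ X i := (mem_cycleSet.mp hxc).1
    have hsingle : ∀ i, ¬ IsBad k X α N {i} x := fun i =>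
      not_isBad_singleton hc hN hpow (by convert hdeg i (x i) (hxX i))
    obtain ⟨J, hJI, hJ2, hJ⟩ := exists_minimal_isBad hsingle (Finset.card_pos.mp hI1) hbad
    exact Finset.mem_biUnion.mpr ⟨J,
      Finset.mem_filter.mpr ⟨Finset.mem_univ _, hJ2, (Finset.card_le_card hJI).trans hI2⟩,
      Finset.mem_filter.mpr ⟨hxc, hJ⟩⟩
  have hsum : δ' * N ^ (k - 1) / 2 ≤ ∑ I ∈ S, ((F I).card : ℝ) :=
    hmany.trans (mod_cast (Finset.card_le_card hcover).trans Finset.card_biUnion_le)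
  have hcard : (S.card : ℝ) ≤ 2 ^ k := by
    have : S.card ≤ 2 ^ k := (Finset.card_le_univ S).trans_eq (by simp)
    exact_mod_cast this
  have hconst : ∑ _I ∈ S, δ' * N ^ (k - 1) / (2 : ℝ) ^ (k + 1) ≤ ∑ I ∈ S, ((F I).card : ℝ) := by
    refine le_trans ?_ hsum
    rw [Finset.sum_const, nsmul_eq_mul]
    calc (S.card : ℝ) * (δ' * N ^ (k - 1) / (2 : ℝ) ^ (k + 1))
        ≤ 2 ^ k * (δ' * N ^ (k - 1) / (2 : ℝ) ^ (k + 1)) := by gcongr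
      _ = δ' * N ^ (k - 1) / 2 := by rw [pow_succ (2 : ℝ) k]; field_simp
  obtain ⟨I, hI, hle⟩ := Finset.exists_le_of_sum_le hS hconst
  obtain ⟨-, hI2, hIk⟩ := Finset.mem_filter.mp hI
  exact ⟨I, hI2, hIk, hle⟩
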